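/- arXiv:1309.2987 — 4 statements merged into one kernel-verified Lean document; each statement's English description precedes it below -/
import Mathlib

section
/- Let f_1, …, f_k : {±1}^n → {0,1} be unate functions and let F(x) = f_1(x) ∨ ⋯ ∨ f_k(x). Then as(F) ≤ C · sqrt(n · log(k)) for an absolute constant C (for k ≥ 2). -/
open Real Finset

noncomputable def sgn (b : Bool) : ℝ := if b then 1 else -1

def flip' {n : ℕ} (x : Fin n → Bool) (i : Fin n) : Fin n → Bool :=
  Function.update x i (!x i)

noncomputable def expect {n : ℕ} (f : (Fin n → Bool) → ℝ) : ℝ :=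
  (∑ x : Fin n → Bool, f x) / 2 ^ n

noncomputable def avgSens {n : ℕ} (f : (Fin n → Bool) → ℝ) : ℝ :=
  (∑ x : Fin n → Bool, ∑ i : Fin n,
    if f x ≠ f (flip' x i) then (1 : ℝ) else 0) / 2 ^ n

/-- `f` is monotone nondecreasing in coordinate `i` (where `true ↦ +1`, `false ↦ -1`). -/
def MonoIn {n : ℕ} (f : (Fin n → Bool) → ℝ) (i : Fin n) : Prop :=
  ∀ x, f (Function.update x i false) ≤ f (Function.update x i true)

/-- `f` is monotone nonincreasing in coordinate `i`. -/
def AntiIn {n : ℕ} (f : (Fin n → Bool) → ℝ) (i : Fin n) : Prop :=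
  ∀ x, f (Function.update x i true) ≤ f (Function.update x i false)

def Unate {n : ℕ} (f : (Fin n → Bool) → ℝ) : Prop :=
  ∀ i, MonoIn f i ∨ AntiIn f i

lemma aux_mgf {n : ℕ} (s : Fin n → ℝ) (hs : ∀ i, s i = 1 ∨ s i = -1) (l : ℝ) :
    ∑ x : Fin n → Bool, Real.exp (l * ∑ i, s i * sgn (x i)) ≤ 2 ^ n * Real.exp (n * (l ^ 2 / 2)) := by
  have h1 : ∀ x : Fin n → Bool, Real.exp (l * ∑ i, s i * sgn (x i))
      = ∏ i, Real.exp (l * (s i * sgn (x i))) := by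
    intro x
    rw [Finset.mul_sum, Real.exp_sum]
  have h2 : ∑ x : Fin n → Bool, ∏ i, Real.exp (l * (s i * sgn (x i)))
      = ∏ i : Fin n, ∑ b : Bool, Real.exp (l * (s i * sgn b)) := by
    rw [Finset.prod_univ_sum, Fintype.piFinset_univ]
  have h3 : ∀ i : Fin n, ∑ b : Bool, Real.exp (l * (s i * sgn b)) = 2 * Real.cosh l := by
    intro i
    rw [Real.cosh_eq]
    rcases hs i with h | h <;> simp [h, sgn] <;> ring
  simp_rw [h1]
  rw [h2]
  simp_rw [h3]
  rw [Finset.prod_const, Finset.card_univ, Fintype.card_fin, mul_pow, Real.exp_nat_mul]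
  have := Real.cosh_le_exp_half_sq l
  have h0 : 0 ≤ Real.cosh l := (Real.cosh_pos l).le
  gcongr

lemma aux_flip {n : ℕ} (x : Fin n → Bool) (i : Fin n) : flip' (flip' x i) i = x := by
  simp [flip']

lemma aux_sgn {n : ℕ} (g : (Fin n → Bool) → ℝ) (i : Fin n) (s : ℝ)
    (hs : (s = 1 ∧ MonoIn g i) ∨ (s = -1 ∧ AntiIn g i)) (x : Fin n → Bool)
    (h : g (flip' x i) < g x) : s * sgn (x i) = 1 := by
  unfold flip' at h
  have hx : g x = g (Function.update x i (x i)) := by simp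
  rw [hx] at h
  rcases hs with ⟨rfl, hm⟩ | ⟨rfl, hm⟩ <;> have := hm x <;> cases hb : x i <;>
    simp [hb, sgn] at h ⊢ <;> linarith

open Classical in
theorem stmt_5 :
    ∃ C : ℝ, 0 < C ∧ ∀ (n k : ℕ), 2 ≤ k → ∀ (f : Fin k → (Fin n → Bool) → ℝ),
      (∀ j x, f j x = 0 ∨ f j x = 1) → (∀ j, Unate (f j)) →
      avgSens (fun x => if ∃ j, f j x = 1 then (1 : ℝ) else 0) ≤
        C * Real.sqrt (n * Real.log k) := by
  refine ⟨5, by norm_num, ?_⟩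
  intro n k hk f h01 hu
  have hk' : (2 : ℝ) ≤ k := by exact_mod_cast hk
  have hlogk : 0 < Real.log k := Real.log_pos (by linarith)
  rcases Nat.eq_zero_or_pos n with rfl | hn
  · simp [avgSens]
  have hn' : (0 : ℝ) < n := by exact_mod_cast hn
  have hs : ∀ j i, ∃ s : ℝ, (s = 1 ∧ MonoIn (f j) i) ∨ (s = -1 ∧ AntiIn (f j) i) := by
    intro j i
    rcases hu j i with h | h
    · exact ⟨1, Or.inl ⟨rfl, h⟩⟩
    · exact ⟨-1, Or.inr ⟨rfl, h⟩⟩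
  choose s hs using hs
  have hs1 : ∀ j i, s j i = 1 ∨ s j i = -1 := fun j i => (hs j i).imp And.left And.left
  have hJ : ∀ x, ∃ j : Fin k, (∃ j, f j x = 1) → f j x = 1 ∧ ∀ l < j, f l x = 0 := by
    intro x
    by_cases hx : ∃ j, f j x = 1
    · obtain ⟨j, hj, hmin⟩ := WellFounded.has_min (wellFounded_lt (α := Fin k)) {j | f j x = 1} hx
      refine ⟨j, fun _ => ⟨hj, fun l hl => ?_⟩⟩
      rcases h01 l x with h | h
      · exact h
      · exact absurd hl (hmin l h)
    · exact ⟨⟨0, by omega⟩, fun h => absurd h hx⟩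
  choose J hJ using hJ
  let h : (Fin n → Bool) → Fin n → ℝ := fun x i =>
    if ∃ j, f j x = 1 then s (J x) i * sgn (x i) else 0
  have hge : ∀ x i, -1 ≤ h x i := by
    intro x i
    simp only [h, sgn]
    rcases hs1 (J x) i with h | h <;> rw [h] <;> split_ifs <;> norm_num
  have key : ∀ x i, f (J x) x = 1 → (∃ j, f j x = 1) → f (J x) (flip' x i) = 0 → h x i = 1 := by
    intro x i h1 hex h0
    simp only [h, if_pos hex]
    exact aux_sgn (f (J x)) i _ (hs _ _) x (by rw [h1, h0]; norm_num)
  have hflip : ∀ (x : Fin n → Bool) (i : Fin n), sgn (flip' x i i) = - sgn (x i) := by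
    intro x i
    cases hb : x i <;> simp [flip', sgn, hb]
  let F : (Fin n → Bool) → ℝ := fun x => if ∃ j, f j x = 1 then (1 : ℝ) else 0
  have edge : ∀ x i, (if F x ≠ F (flip' x i) then (1 : ℝ) else 0) ≤ h x i + h (flip' x i) i := by
    intro x i
    by_cases hx : ∃ j, f j x = 1 <;> by_cases hy : ∃ j, f j (flip' x i) = 1
    · have hF : F x = F (flip' x i) := by simp only [F, if_pos hx, if_pos hy]
      rw [if_neg (by simpa using hF)]
      obtain ⟨hx1, hx2⟩ := hJ x hx
      obtain ⟨hy1, hy2⟩ := hJ _ hy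
      rcases lt_trichotomy (J x) (J (flip' x i)) with hlt | heq | hlt
      · have := key x i hx1 hx (hy2 _ hlt)
        linarith [hge (flip' x i) i]
      · simp only [h, if_pos hx, if_pos hy]
        rw [hflip, heq]
        linarith
      · have := key (flip' x i) i hy1 hy (by rw [aux_flip]; exact hx2 _ hlt)
        linarith [hge x i]
    · have h1 := key x i (hJ x hx).1 hx
        ((h01 _ _).resolve_right fun h => hy ⟨_, h⟩)
      have h2 : h (flip' x i) i = 0 := by simp only [h, if_neg hy]
      rw [h1, h2]; split_ifs <;> norm_num
    · have h1 := key (flip' x i) i (hJ _ hy).1 hy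
        ((h01 _ _).resolve_right fun h => hx ⟨_, by rw [aux_flip] at h; exact h⟩)
      have h2 : h x i = 0 := by simp only [h, if_neg hx]
      rw [h1, h2]; split_ifs <;> norm_num
    · have hF : F x = F (flip' x i) := by simp only [F, if_neg hx, if_neg hy]
      rw [if_neg (by simpa using hF)]
      simp only [h, if_neg hx, if_neg hy]; norm_num
  let M : (Fin n → Bool) → ℝ := fun x => ∑ i, h x i
  have hsum : ∑ x, ∑ i, (if F x ≠ F (flip' x i) then (1 : ℝ) else 0) ≤ 2 * ∑ x, M x := by
    calc _ ≤ ∑ x, ∑ i, (h x i + h (flip' x i) i) :=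
          Finset.sum_le_sum fun x _ => Finset.sum_le_sum fun i _ => edge x i
      _ = ∑ x, M x + ∑ x, ∑ i, h (flip' x i) i := by
          simp only [Finset.sum_add_distrib, M]
      _ = 2 * ∑ x, M x := by
          have : ∑ x, ∑ i, h (flip' x i) i = ∑ x, M x := by
            simp only [M]
            rw [Finset.sum_comm, Finset.sum_comm (f := fun x i => h x i)]
            refine Finset.sum_congr rfl fun i _ => ?_
            exact Fintype.sum_equiv (Function.Involutive.toPerm (fun x => flip' x i)
              (fun x => aux_flip x i)) _ _ (fun x => rfl)
          rw [this]; ring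
  have hcard : ∑ x : Fin n → Bool, (1 : ℝ) = 2 ^ n := by simp
  -- exponential moment
  have hexp : ∀ l : ℝ, ∑ x, Real.exp (l * M x) ≤ 2 ^ n * (2 * k * Real.exp (n * (l ^ 2 / 2))) := by
    intro l
    have hE : 1 ≤ Real.exp (n * (l ^ 2 / 2)) := Real.one_le_exp (by positivity)
    calc ∑ x, Real.exp (l * M x)
        ≤ ∑ x : Fin n → Bool, (1 + ∑ j, Real.exp (l * ∑ i, s j i * sgn (x i))) := by
          refine Finset.sum_le_sum fun x _ => ?_
          by_cases hx : ∃ j, f j x = 1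
          · have : M x = ∑ i, s (J x) i * sgn (x i) := by simp only [M, h, if_pos hx]
            rw [this]
            have := Finset.single_le_sum (f := fun j => Real.exp (l * ∑ i, s j i * sgn (x i)))
              (fun j _ => (Real.exp_pos _).le) (Finset.mem_univ (J x))
            linarith
          · have : M x = 0 := by simp only [M, h, if_neg hx, Finset.sum_const_zero]
            rw [this, mul_zero, Real.exp_zero]
            have := Finset.sum_nonneg (s := Finset.univ)
              (f := fun j => Real.exp (l * ∑ i, s j i * sgn (x i))) (fun j _ => (Real.exp_pos _).le)
            linarith
      _ = 2 ^ n + ∑ j, ∑ x : Fin n → Bool, Real.exp (l * ∑ i, s j i * sgn (x i)) := by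
          rw [Finset.sum_add_distrib, hcard, Finset.sum_comm]
      _ ≤ 2 ^ n + ∑ j : Fin k, 2 ^ n * Real.exp (n * (l ^ 2 / 2)) := by
          gcongr with j
          exact aux_mgf (s j) (hs1 j) l
      _ = 2 ^ n * (1 + k * Real.exp (n * (l ^ 2 / 2))) := by
          simp; ring
      _ ≤ _ := by
          gcongr
          nlinarith
  have hM : ∀ l : ℝ, l * ∑ x, M x ≤ 2 ^ n * (Real.log (2 * k) + n * (l ^ 2 / 2)) := by
    intro l
    set L := Real.log (2 * k) + n * (l ^ 2 / 2) with hL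
    have hLe : Real.exp L = 2 * k * Real.exp (n * (l ^ 2 / 2)) := by
      rw [hL, Real.exp_add, Real.exp_log (by positivity)]
    have h1 : ∑ x, (l * M x - L + 1) ≤ ∑ x, Real.exp (l * M x) / Real.exp L := by
      refine Finset.sum_le_sum fun x _ => ?_
      rw [← Real.exp_sub]; exact Real.add_one_le_exp _
    rw [← Finset.sum_div] at h1
    have h2 : (∑ x, Real.exp (l * M x)) / Real.exp L ≤ 2 ^ n := by
      rw [div_le_iff₀ (Real.exp_pos _), hLe]; exact hexp l
    have h3 : ∑ x, (l * M x - L + 1) = l * ∑ x, M x - 2 ^ n * L + 2 ^ n := by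
      rw [Finset.sum_add_distrib, Finset.sum_sub_distrib, hcard, ← Finset.mul_sum]
      simp
    linarith
  have hlog2 : Real.log (2 * k) ≤ 2 * Real.log k := by
    rw [Real.log_mul (by norm_num) (by positivity)]
    have := Real.log_le_log (by norm_num) hk'
    linarith
  set R := Real.sqrt (n * Real.log k) with hR
  have hRpos : 0 < R := Real.sqrt_pos.mpr (by positivity)
  have hRsq : R ^ 2 = n * Real.log k := Real.sq_sqrt (by positivity)
  have hfin : ∑ x, M x ≤ 2 ^ n * (5 / 2 * R) := by
    have h1 := hM (R / n)
    have h2 : n * ((R / n) ^ 2 / 2) = Real.log k / 2 := by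
      rw [div_pow, hRsq]; field_simp
    rw [h2] at h1
    have h3 : R / n * ∑ x, M x ≤ R / n * (2 ^ n * (5 / 2 * R)) := by
      have h4 : R / n * (2 ^ n * (5 / 2 * R)) = 2 ^ n * (5 / 2 * Real.log k) := by
        have : R / n * (2 ^ n * (5 / 2 * R)) = 2 ^ n * (5 / 2 * (R ^ 2 / n)) := by ring
        rw [this, hRsq]; field_simp
      rw [h4]
      refine h1.trans ?_
      gcongr
      linarith
    exact le_of_mul_le_mul_left h3 (by positivity)
  unfold avgSens
  rw [div_le_iff₀ (by positivity)]
  refine hsum.trans ?_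
  linarith
end

section
/- Let F : {±1}^n → {0,1} be the indicator function of an intersection of k halfspaces, i.e., F(x) = 1 if and only if ⟨w_j, x⟩ ≥ θ_j for all j = 1,…,k, for some real vectors w_j ∈ R^n and thresholds θ_j. Then as(F) ≤ C · sqrt(n · log(k)) for an absolute constant C (for k ≥ 2). -/
open Real Finset

lemma sgn_cases (b : Bool) : sgn b = 1 ∨ sgn b = -1 := by
  cases b <;> simp [sgn]

lemma sgn_not (b : Bool) : sgn (!b) = - sgn b := by
  cases b <;> simp [sgn]

lemma flip_flip_my {n : ℕ} (x : Fin n → Bool) (j : Fin n) : flip' (flip' x j) j = x := by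
  simp [flip']

lemma flip_self {n : ℕ} (x : Fin n → Bool) (j : Fin n) : flip' x j j = !x j := by
  simp [flip']

lemma lin_flip {n : ℕ} (w : Fin n → ℝ) (x : Fin n → Bool) (j : Fin n) :
    ∑ i, w i * sgn (flip' x j i) = ∑ i, w i * sgn (x i) - 2 * (w j * sgn (x j)) := by
  rw [← Finset.add_sum_erase _ _ (Finset.mem_univ j),
    ← Finset.add_sum_erase (a := j) univ (fun i => w i * sgn (x i)) (Finset.mem_univ j), flip_self, sgn_not]
  have : ∑ i ∈ univ.erase j, w i * sgn (flip' x j i) = ∑ i ∈ univ.erase j, w i * sgn (x i) := by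
    apply Finset.sum_congr rfl
    intro i hi
    rw [flip', Function.update_of_ne (Finset.ne_of_mem_erase hi)]
  rw [this]; ring

lemma mgf {n : ℕ} (s : Fin n → ℝ) (hs : ∀ j, s j = 1 ∨ s j = -1) (t : ℝ) :
    ∑ x : Fin n → Bool, exp (t * ∑ j, s j * sgn (x j)) ≤ 2 ^ n * exp (n * t ^ 2 / 2) := by
  have h1 : ∑ x : Fin n → Bool, exp (t * ∑ j, s j * sgn (x j))
      = ∏ j : Fin n, ∑ b : Bool, exp (t * (s j * sgn b)) := by
    rw [Fintype.prod_sum]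
    apply Finset.sum_congr rfl
    intro x _
    rw [Finset.mul_sum, Real.exp_sum]
  have h2 : ∀ j, ∑ b : Bool, exp (t * (s j * sgn b)) = 2 * cosh t := by
    intro j
    rw [Real.cosh_eq]
    rcases hs j with h | h <;> simp [h, sgn] <;> ring
  rw [h1, Finset.prod_congr rfl (fun j _ => h2 j)]
  simp only [Finset.prod_const, Finset.card_univ, Fintype.card_fin, mul_pow]
  have h3 : cosh t ^ n ≤ exp (t ^ 2 / 2) ^ n :=
    pow_le_pow_left₀ (Real.cosh_pos t).le (Real.cosh_le_exp_half_sq t) n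
  rw [← Real.exp_nat_mul] at h3
  have : (n : ℝ) * t ^ 2 / 2 = n * (t ^ 2 / 2) := by ring
  rw [this]
  gcongr

lemma max_bound {n k : ℕ} (hk : 2 ≤ k) (s : Fin k → Fin n → ℝ)
    (hs : ∀ i j, s i j = 1 ∨ s i j = -1) (h : (Fin n → Bool) → ℝ)
    (hh : ∀ x, h x = 0 ∨ ∃ i, h x = ∑ j, s i j * sgn (x j)) (t : ℝ) :
    t * ((∑ x, h x) / 2 ^ n) ≤ log k + n * t ^ 2 / 2 + 1 := by
  set E := exp (n * t ^ 2 / 2) with hE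
  have hk0 : (2 : ℝ) ≤ k := by exact_mod_cast hk
  have hE1 : 1 ≤ E := Real.one_le_exp (by positivity)
  have hK : 0 < k * E := by positivity
  have hlog : log (k * E) = log k + n * t ^ 2 / 2 := by
    rw [Real.log_mul (by positivity) (by positivity), hE, Real.log_exp]
  have pt : ∀ x, t * h x ≤ log k + n * t ^ 2 / 2 - 1
      + (1 + ∑ i, exp (t * ∑ j, s i j * sgn (x j))) / (k * E) := by
    intro x
    have h1 : exp (t * h x) ≤ 1 + ∑ i, exp (t * ∑ j, s i j * sgn (x j)) := by
      rcases hh x with h0 | ⟨i, hi⟩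
      · rw [h0]; simp; positivity
      · rw [hi]
        have := Finset.single_le_sum (f := fun i => exp (t * ∑ j, s i j * sgn (x j)))
          (fun i _ => (Real.exp_pos _).le) (Finset.mem_univ i)
        linarith
    have h2 := Real.log_le_sub_one_of_pos (x := exp (t * h x) / (k * E)) (by positivity)
    rw [Real.log_div (by positivity) (by positivity), Real.log_exp, hlog] at h2
    have h3 : exp (t * h x) / (k * E) ≤ (1 + ∑ i, exp (t * ∑ j, s i j * sgn (x j))) / (k * E) := by
      gcongr
    linarith
  have hsum := Finset.sum_le_sum (s := univ) (fun x _ => pt x)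
  rw [← Finset.mul_sum, Finset.sum_add_distrib, ← Finset.sum_div, Finset.sum_add_distrib,
    Finset.sum_comm] at hsum
  have hm : ∑ i, ∑ x : Fin n → Bool, exp (t * ∑ j, s i j * sgn (x j)) ≤ k * (2 ^ n * E) := by
    have := Finset.sum_le_sum (s := univ) (fun i _ => mgf (s i) (hs i) t)
    simpa using this
  simp only [Finset.sum_const, Finset.card_univ, Fintype.card_pi, Fintype.card_bool,
    Finset.prod_const, Fintype.card_fin, nsmul_eq_mul] at hsum
  push_cast at hsum
  have h4 : ((2:ℝ) ^ n * 1 + ∑ i, ∑ x : Fin n → Bool, exp (t * ∑ j, s i j * sgn (x j))) / (k * E)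
      ≤ 2 ^ n * 2 := by
    rw [div_le_iff₀ hK]
    have : (1:ℝ) ≤ k * E := by nlinarith
    have h2n : (0:ℝ) < 2 ^ n := by positivity
    nlinarith [mul_le_mul_of_nonneg_left this h2n.le]
  rw [← mul_div_assoc, div_le_iff₀ (by positivity)]
  nlinarith

theorem stmt_6 :
    ∃ C : ℝ, 0 < C ∧ ∀ (n k : ℕ), 2 ≤ k →
      ∀ (w : Fin k → Fin n → ℝ) (θ : Fin k → ℝ),
      avgSens (fun x => if ∀ j, θ j ≤ ∑ i : Fin n, w j i * sgn (x i)
          then (1 : ℝ) else 0) ≤ C * Real.sqrt (n * Real.log k) := by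
  classical
  refine ⟨7, by norm_num, ?_⟩
  intro n k hk w θ
  rcases Nat.eq_zero_or_pos n with hn | hn
  · subst hn; simp [avgSens]
  set S : Fin k → (Fin n → Bool) → ℝ := fun j x => ∑ i : Fin n, w j i * sgn (x i) with hS
  have hne : Nonempty (Fin k) := ⟨⟨0, by omega⟩⟩
  have hidx : ∀ x, ∃ i, (¬ ∀ j, θ j ≤ S j x) → S i x < θ i ∧ ∀ j < i, θ j ≤ S j x := by
    intro x
    by_cases hx : ∀ j, θ j ≤ S j x
    · exact ⟨hne.some, fun h => absurd hx h⟩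
    · push Not at hx
      obtain ⟨i, hi, hmin⟩ := WellFounded.has_min (wellFounded_lt (α := Fin k))
        {i | S i x < θ i} hx
      exact ⟨i, fun _ => ⟨hi, fun j hj => not_lt.1 fun h => hmin j h hj⟩⟩
  choose idx hidx using hidx
  set s : Fin k → Fin n → ℝ := fun i j => if w i j ≤ 0 then 1 else -1 with hsdef
  have hs : ∀ i j, s i j = 1 ∨ s i j = -1 := by
    intro i j; simp only [hsdef]; split_ifs <;> simp
  have key : ∀ i j x, S i x < θ i → θ i ≤ S i (flip' x j) → s i j * sgn (x j) = 1 := by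
    intro i j x h1 h2
    have h3 : S i (flip' x j) = S i x - 2 * (w i j * sgn (x j)) := lin_flip _ _ _
    have h4 : w i j * sgn (x j) < 0 := by linarith
    simp only [hsdef]
    rcases sgn_cases (x j) with h | h <;> rw [h] at h4 ⊢ <;> split_ifs <;> linarith
  have hge : ∀ i j b, -1 ≤ s i j * sgn b := by
    intro i j b
    rcases hs i j with h | h <;> rcases sgn_cases b with h' | h' <;> rw [h, h'] <;> norm_num
  set g : (Fin n → Bool) → Fin n → ℝ := fun x j =>
    if ∀ j, θ j ≤ S j x then 0 else s (idx x) j * sgn (x j) with hg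
  set F : (Fin n → Bool) → ℝ := fun x => if ∀ j, θ j ≤ S j x then (1 : ℝ) else 0 with hF
  have edge : ∀ x j, (if F x ≠ F (flip' x j) then (1:ℝ) else 0) ≤ g x j + g (flip' x j) j := by
    intro x j
    by_cases hx : ∀ j, θ j ≤ S j x <;> by_cases hy : ∀ i, θ i ≤ S i (flip' x j)
    · simp only [hF, hg, if_pos hx, if_pos hy]; simp
    · have := key (idx (flip' x j)) j (flip' x j) (hidx _ hy).1 (by rw [flip_flip_my]; exact hx _)
      simp only [hF, hg, if_pos hx, if_neg hy, this]; simp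
    · have := key (idx x) j x (hidx _ hx).1 (hy _)
      simp only [hF, hg, if_neg hx, if_pos hy, this]; simp
    · simp only [hF, hg, if_neg hx, if_neg hy]
      simp only [ne_eq, not_true_eq_false, if_false]
      rcases lt_trichotomy (idx x) (idx (flip' x j)) with h | h | h
      · have := key (idx x) j x (hidx _ hx).1 ((hidx _ hy).2 _ h)
        linarith [hge (idx (flip' x j)) j (flip' x j j)]
      · rw [← h, flip_self, sgn_not]; linarith
      · have := key (idx (flip' x j)) j (flip' x j) (hidx _ hy).1
          (by rw [flip_flip_my]; exact (hidx _ hx).2 _ h)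
        linarith [hge (idx x) j (x j)]
  have hflip : ∀ j, ∑ x, g (flip' x j) j = ∑ x, g x j := by
    intro j
    exact Equiv.sum_comp (⟨fun x => flip' x j, fun x => flip' x j,
      fun x => flip_flip_my x j, fun x => flip_flip_my x j⟩ : (Fin n → Bool) ≃ (Fin n → Bool))
      (fun x => g x j)
  have htot : avgSens F ≤ 2 * ((∑ x, ∑ j, g x j) / 2 ^ n) := by
    rw [avgSens, ← mul_div_assoc]
    gcongr
    calc _ ≤ ∑ x, ∑ j, (g x j + g (flip' x j) j) :=
          Finset.sum_le_sum fun x _ => Finset.sum_le_sum fun j _ => edge x j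
      _ = 2 * ∑ x, ∑ j, g x j := by
          simp only [Finset.sum_add_distrib]
          rw [Finset.sum_comm (f := fun x j => g (flip' x j) j), Finset.sum_congr rfl (fun j _ => hflip j),
            Finset.sum_comm (f := fun j x => g x j)]
          ring
  have hb := max_bound hk s hs (fun x => ∑ j, g x j) (by
    intro x
    by_cases hx : ∀ j, θ j ≤ S j x
    · left; simp only [hg, if_pos hx]; simp
    · right; exact ⟨idx x, by simp only [hg, if_neg hx]⟩)
  set M := (∑ x, ∑ j, g x j) / 2 ^ n with hM
  have hn' : (0:ℝ) < n := by exact_mod_cast hn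
  have hl : 1 / 2 < log k := by
    have : log 2 ≤ log k := Real.log_le_log (by norm_num) (by exact_mod_cast hk)
    linarith [Real.log_two_gt_d9]
  have hr : 0 < sqrt (n * log k) := Real.sqrt_pos.2 (by positivity)
  have hr2 : sqrt (n * log k) ^ 2 = n * log k := Real.sq_sqrt (by positivity)
  set r := sqrt (n * log k) with hrdef
  have hb' := hb (r / n)
  have e1 : (n:ℝ) * (r / n) ^ 2 / 2 = log k / 2 := by
    rw [div_pow, hr2]; field_simp
  rw [e1] at hb'
  have h5 : r / n * M ≤ 7 / 2 * log k := by linarith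
  have h6 : r * M ≤ r * (7 / 2 * r) := by
    have : r * M = n * (r / n * M) := by field_simp
    rw [this]
    nlinarith
  have h7 := le_of_mul_le_mul_left h6 hr
  linarith
end

section
/- For every integer n ≥ 1 and every ε with 2^{−n} < ε < 1/2, there exists a threshold t such that the function f : {±1}^n → {0,1} defined by f(x) = 1 iff Σ_{i=1}^n x_i > t satisfies E[f(x)] ≥ ε and as(f) ≥ c · E[f(x)] · sqrt(n · log(1/ε)) for an absolute constant c > 0. -/
open Real Finset

noncomputable def SS {n : ℕ} (x : Fin n → Bool) : ℝ := ∑ i : Fin n, sgn (x i)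

noncomputable def NN (n : ℕ) (a : ℝ) : ℝ := ∑ x : Fin n → Bool, if a ≤ SS x then (1:ℝ) else 0

lemma flipp_invol {n : ℕ} (i : Fin n) : Function.Involutive (fun x : Fin n → Bool => flip' x i) := by
  intro x
  simp [flip']

lemma sum_flipp {n : ℕ} (i : Fin n) (F : (Fin n → Bool) → ℝ) :
    ∑ x, F (flip' x i) = ∑ x, F x :=
  Equiv.sum_comp (flipp_invol i).toPerm F

lemma sens_ge {n : ℕ} (f : (Fin n → Bool) → ℝ) (hf : ∀ x, f x = 0 ∨ f x = 1) :
    2 * ∑ x, f x * SS x ≤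
      ∑ x : Fin n → Bool, ∑ i : Fin n, if f x ≠ f (flip' x i) then (1 : ℝ) else 0 := by
  have h1 : ∑ x, f x * SS x = ∑ i : Fin n, ∑ x, f x * sgn (x i) := by
    rw [Finset.sum_comm]
    simp [SS, Finset.mul_sum]
  rw [h1, Finset.mul_sum]
  refine le_of_le_of_eq ?_ Finset.sum_comm
  apply Finset.sum_le_sum
  intro i _
  have h2 := sum_flipp i (fun x => f x * sgn (x i))
  have h3 : 2 * ∑ x, f x * sgn (x i) = ∑ x, (f x * sgn (x i) + f (flip' x i) * sgn (flip' x i i)) := by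
    rw [Finset.sum_add_distrib, h2]; ring
  rw [h3]
  apply Finset.sum_le_sum
  intro x _
  have h4 : flip' x i i = ! x i := by simp [flip']
  rw [h4, sgn_not]
  rcases hf x with h | h <;> rcases hf (flip' x i) with h' | h' <;> rw [h, h'] <;>
    cases x i <;> simp [sgn]

lemma sum_neg {n : ℕ} (F : ℝ → ℝ) :
    ∑ x : Fin n → Bool, F (- SS x) = ∑ x : Fin n → Bool, F (SS x) := by
  have hinv : Function.Involutive (fun x : Fin n → Bool => fun i => ! x i) := by
    intro x; simp
  rw [← Equiv.sum_comp hinv.toPerm (fun x => F (SS x))]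
  apply Finset.sum_congr rfl
  intro x _
  simp [SS, sgn_not]

lemma sum_cons {n : ℕ} (F : ℝ → ℝ) :
    ∑ x : Fin (n+1) → Bool, F (SS x) =
      ∑ x : Fin n → Bool, (F (SS x + 1) + F (SS x - 1)) := by
  rw [← Equiv.sum_comp (Fin.consEquiv (fun _ : Fin (n+1) => Bool)), Fintype.sum_prod_type]
  simp [SS, Fin.sum_univ_succ, sgn, Finset.sum_add_distrib, Fin.consEquiv]
  congr 1 <;> (apply Finset.sum_congr rfl; intro x _; congr 1; ring)

lemma sum_one (n : ℕ) : ∑ _x : Fin n → Bool, (1:ℝ) = 2 ^ n := by simp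

lemma mom2 (n : ℕ) : ∑ x : Fin n → Bool, (SS x)^2 = n * 2 ^ n := by
  induction n with
  | zero => simp [SS]
  | succ n ih =>
    rw [sum_cons (fun s => s^2)]
    have : ∀ x : Fin n → Bool, (SS x + 1)^2 + (SS x - 1)^2 = 2 * (SS x)^2 + 2 * 1 := by
      intro x; ring
    simp only [this, Finset.sum_add_distrib, ← Finset.mul_sum, ih, sum_one]
    push_cast; ring

lemma mom4 (n : ℕ) : ∑ x : Fin n → Bool, (SS x)^4 = (3 * n^2 - 2 * n) * 2 ^ n := by
  induction n with
  | zero => simp [SS]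
  | succ n ih =>
    rw [sum_cons (fun s => s^4)]
    have : ∀ x : Fin n → Bool, (SS x + 1)^4 + (SS x - 1)^4 =
        2 * (SS x)^4 + 12 * (SS x)^2 + 2 * 1 := by
      intro x; ring
    simp only [this, Finset.sum_add_distrib, ← Finset.mul_sum, ih, mom2, sum_one]
    push_cast; ring

lemma NN_zero (n : ℕ) : 2 ^ n / 2 ≤ NN n 0 := by
  have h := sum_neg (n := n) (fun s => if 0 ≤ s then (1:ℝ) else 0)
  have h2 : ∑ _x : Fin n → Bool, (1:ℝ) ≤ ∑ x : Fin n → Bool,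
      ((if 0 ≤ SS x then (1:ℝ) else 0) + (if 0 ≤ - SS x then (1:ℝ) else 0)) := by
    apply Finset.sum_le_sum
    intro x _
    split_ifs <;> norm_num
    linarith
  rw [Finset.sum_add_distrib, h, sum_one] at h2
  unfold NN
  linarith

lemma NN_sqrt (m : ℕ) (hm : 1 ≤ m) : 2 ^ m * (3/32) ≤ NN m (√m / 2) := by
  have h := sum_neg (n := m) (fun s => if √m / 2 ≤ s then (1:ℝ) else 0)
  have hm' : (1:ℝ) ≤ m := by exact_mod_cast hm
  have hs : √(m:ℝ)^2 = m := Real.sq_sqrt (by positivity)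
  have hs0 : 0 < √(m:ℝ) := by positivity
  have h2 : ∑ x : Fin m → Bool, (33/4 * m * (SS x)^2 - (SS x)^4 - 2 * m^2 * 1) ≤
      ∑ x : Fin m → Bool, 16 * (m:ℝ)^2 *
      ((if √m / 2 ≤ SS x then (1:ℝ) else 0) + (if √m / 2 ≤ - SS x then (1:ℝ) else 0)) := by
    apply Finset.sum_le_sum
    intro x _
    have e1 : 33/4 * m * (SS x)^2 - (SS x)^4 - 2 * m^2 * 1 ≤ 16 * (m:ℝ)^2 := by
      nlinarith [sq_nonneg ((SS x)^2 - 33/8 * m)]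
    have e2 : 0 ≤ 16 * (m:ℝ)^2 := by positivity
    split_ifs with a b b
    · linarith
    · linarith
    · linarith
    · push Not at a b
      have : (SS x)^2 ≤ m / 4 := by nlinarith
      nlinarith
  rw [← Finset.mul_sum, Finset.sum_add_distrib, h, Finset.sum_sub_distrib, Finset.sum_sub_distrib,
    ← Finset.mul_sum, ← Finset.mul_sum, mom2, mom4, sum_one] at h2
  change _ ≤ 16 * (m:ℝ)^2 * (NN m (√m / 2) + NN m (√m / 2)) at h2
  have hp : (0:ℝ) < 2 ^ m := by positivity
  have h3 : (m:ℝ)^2 * (2 ^ m * 3) ≤ (m:ℝ)^2 * (32 * NN m (√m / 2)) := by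
    nlinarith [mul_pos hp (by linarith : (0:ℝ) < m), mul_pos hp (by positivity : (0:ℝ) < (m:ℝ)^2)]
  have := le_of_mul_le_mul_left h3 (by positivity)
  linarith

lemma NN_nonneg (n : ℕ) (a : ℝ) : 0 ≤ NN n a := by
  unfold NN; apply Finset.sum_nonneg; intros; split_ifs <;> norm_num

lemma NN_add (m n : ℕ) (a b : ℝ) : NN m a * NN n b ≤ NN (m+n) (a+b) := by
  unfold NN
  rw [← Equiv.sum_comp (Fin.appendEquiv m n), Fintype.sum_prod_type, Finset.sum_mul_sum]
  apply Finset.sum_le_sum; intro x _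
  apply Finset.sum_le_sum; intro y _
  have : SS (Fin.appendEquiv m n (x, y)) = SS x + SS y := by
    simp [SS, Fin.sum_univ_add, Fin.appendEquiv]
  rw [this]
  split_ifs <;> norm_num
  linarith

lemma NN_block (m : ℕ) (hm : 1 ≤ m) (k : ℕ) :
    2 ^ (k * m) * (3/32)^k ≤ NN (k * m) (k * (√m / 2)) := by
  induction k with
  | zero => 
    rw [Nat.zero_mul]
    simp [NN, SS]
  | succ k ih =>
    have h := NN_add (k*m) m (k * (√m / 2)) (√m / 2)
    have e : (((k+1 : ℕ):ℝ)) * (√m / 2) = k * (√m / 2) + √m / 2 := by push_cast; ring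
    rw [e, Nat.succ_mul]
    refine le_trans ?_ h
    calc (2:ℝ) ^ (k * m + m) * (3/32)^(k+1) = (2 ^ (k * m) * (3/32)^k) * (2 ^ m * (3/32)) := by
          rw [pow_add, pow_succ]; ring
      _ ≤ _ := mul_le_mul ih (NN_sqrt m hm) (by positivity) (NN_nonneg _ _)

lemma NN_main (n m k : ℕ) (hm : 1 ≤ m) (hk : k * m ≤ n) :
    2 ^ n * ((3/32)^k / 2) ≤ NN n (k * (√m / 2)) := by
  obtain ⟨r, rfl⟩ := Nat.exists_eq_add_of_le hk
  have h := NN_add (k*m) r (k * (√m / 2)) 0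
  rw [add_zero] at h
  refine le_trans ?_ h
  calc (2:ℝ) ^ (k * m + r) * ((3/32)^k/2) = (2 ^ (k * m) * (3/32)^k) * (2 ^ r / 2) := by
          rw [pow_add]; ring
      _ ≤ _ := mul_le_mul (NN_block m hm k) (NN_zero r) (by positivity) (NN_nonneg _ _)

lemma SS_int {n : ℕ} (x : Fin n → Bool) : ∃ z : ℤ, SS x = z := by
  refine ⟨∑ i, if x i then 1 else -1, ?_⟩
  push_cast
  simp [SS, sgn]

lemma thr {n : ℕ} (a : ℝ) (x : Fin n → Bool) :
    ((⌈a⌉:ℝ) - 1 < ∑ i : Fin n, sgn (x i)) ↔ a ≤ SS x := by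
  change ((⌈a⌉:ℝ) - 1 < SS x) ↔ _
  obtain ⟨z, hz⟩ := SS_int x
  rw [hz, ← Int.ceil_le]
  constructor
  · intro h
    have : ⌈a⌉ - 1 < z := by exact_mod_cast h
    omega
  · intro h
    have : ⌈a⌉ - 1 < z := by omega
    exact_mod_cast this

lemma fin_red (n : ℕ) (ε c a : ℝ) (h1 : ε * 2 ^ n ≤ NN n a)
    (h2 : c * NN n a * √(n * Real.log (1 / ε)) ≤
      2 * ∑ x : Fin n → Bool, (if a ≤ SS x then (1:ℝ) else 0) * SS x) :
    ∃ t : ℝ,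
        ε ≤ expect (fun x : Fin n → Bool =>
            if t < ∑ i : Fin n, sgn (x i) then (1 : ℝ) else 0) ∧
        c * expect (fun x : Fin n → Bool =>
              if t < ∑ i : Fin n, sgn (x i) then (1 : ℝ) else 0) *
            Real.sqrt (n * Real.log (1 / ε)) ≤
          avgSens (fun x : Fin n → Bool =>
            if t < ∑ i : Fin n, sgn (x i) then (1 : ℝ) else 0) := by
  refine ⟨(⌈a⌉:ℝ) - 1, ?_⟩
  simp only [thr]
  have hp : (0:ℝ) < 2 ^ n := by positivity
  have he : expect (fun x : Fin n → Bool => if a ≤ SS x then (1:ℝ) else 0) = NN n a / 2 ^ n := rfl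
  rw [he]
  constructor
  · rwa [le_div_iff₀ hp]
  · have h3 := sens_ge (fun x : Fin n → Bool => if a ≤ SS x then (1:ℝ) else 0)
      (by intro x; split_ifs <;> simp)
    have h4 := h2.trans h3
    unfold avgSens
    calc _ = (c * NN n a * √(n * Real.log (1 / ε))) / 2 ^ n := by ring
      _ ≤ _ := by gcongr

lemma a_le (n : ℕ) (a b : ℝ) (hab : 0 ≤ a) (hb : a ≤ b) :
    b * NN n b ≤ ∑ x : Fin n → Bool, (if a ≤ SS x then (1:ℝ) else 0) * SS x := by
  unfold NN
  rw [Finset.mul_sum]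
  apply Finset.sum_le_sum
  intro x _
  split_ifs <;> linarith

theorem stmt_9 :
    ∃ c : ℝ, 0 < c ∧ ∀ (n : ℕ) (ε : ℝ), 1 ≤ n → (2 : ℝ) ^ (-(n : ℤ)) < ε →
      ε < 1 / 2 →
      ∃ t : ℝ,
        ε ≤ expect (fun x : Fin n → Bool =>
            if t < ∑ i : Fin n, sgn (x i) then (1 : ℝ) else 0) ∧
        c * expect (fun x : Fin n → Bool =>
              if t < ∑ i : Fin n, sgn (x i) then (1 : ℝ) else 0) *
            Real.sqrt (n * Real.log (1 / ε)) ≤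
          avgSens (fun x : Fin n → Bool =>
            if t < ∑ i : Fin n, sgn (x i) then (1 : ℝ) else 0) := by
  refine ⟨1/64, by norm_num, ?_⟩
  intro n ε hn hε hε2
  have hε0 : 0 < ε := lt_trans (by positivity) hε
  have hp : (0:ℝ) < 2 ^ n := by positivity
  have hn' : (1:ℝ) ≤ n := by exact_mod_cast hn
  set L := Real.log (1 / ε) with hL
  have hLε : Real.exp (-L) = ε := by
    rw [hL, one_div, Real.log_inv, neg_neg, Real.exp_log hε0]
  have l2 : 0 < Real.log 2 := Real.log_pos (by norm_num)
  have l2' : Real.log 2 < 1 := by linarith [Real.log_two_lt_d9]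
  have hL0 : 0 < L := Real.log_pos (by rw [lt_div_iff₀ hε0]; linarith)
  have hLn : L < n * Real.log 2 := by
    have := Real.log_lt_log (by positivity) hε
    rw [Real.log_zpow] at this
    rw [hL, one_div, Real.log_inv]
    push_cast at this
    linarith
  set k := ⌊L / (6 * Real.log 2)⌋₊ with hk
  have hk1 : (k:ℝ) ≤ L / (6 * Real.log 2) := Nat.floor_le (by positivity)
  have hk2 : L / (6 * Real.log 2) < k + 1 := Nat.lt_floor_add_one _
  rw [le_div_iff₀ (by positivity)] at hk1
  rw [div_lt_iff₀ (by positivity)] at hk2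
  rcases Nat.eq_zero_or_pos k with h0 | h0
  · apply fin_red n ε _ 0
    · have := NN_zero n
      nlinarith
    · rw [h0] at hk2
      have hL6 : L ≤ 9 := by norm_num at hk2; linarith
      have h1 : √(n * L) ≤ 3 * √n := by
        rw [Real.sqrt_le_left (by positivity), mul_pow, Real.sq_sqrt (by positivity)]
        nlinarith
      have h2 := a_le n 0 (√n / 2) le_rfl (by positivity)
      have h3 := NN_sqrt n hn
      have h4 : NN n 0 ≤ 2 ^ n := by
        rw [← sum_one]
        apply Finset.sum_le_sum
        intro x _
        split_ifs <;> norm_num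
      calc 1/64 * NN n 0 * √(n * L) ≤ 1/64 * 2 ^ n * (3 * √n) := by gcongr
        _ ≤ 2 * (√n / 2 * (2 ^ n * (3/32))) := by
          have : 0 ≤ (2:ℝ) ^ n * √n := by positivity
          nlinarith
        _ ≤ 2 * (√n / 2 * NN n (√n / 2)) := by gcongr
        _ ≤ _ := by linarith
  · have hk1' : (1:ℝ) ≤ k := by exact_mod_cast h0
    have hkn : k ≤ n := by
      have : (k:ℝ) ≤ n := by nlinarith
      exact_mod_cast this
    set m := n / k with hm
    have hm1 : 1 ≤ m := (Nat.one_le_div_iff h0).2 hkn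
    have hkm : k * m ≤ n := Nat.mul_div_le n k
    have hmn : n ≤ 2 * (k * m) := by
      have : n < k * (m + 1) := Nat.lt_mul_div_succ n h0
      nlinarith
    have hmn' : (n:ℝ) ≤ 2 * (k * m) := by exact_mod_cast hmn
    apply fin_red n ε _ (k * (√m / 2))
    · refine le_trans ?_ (NN_main n m k hm1 hkm)
      rw [mul_comm]
      gcongr
      have e1 : ε ≤ (1/64)^k := by
        have : ((1:ℝ)/64)^k = Real.exp (-(k * (6 * Real.log 2))) := by
          have : (1:ℝ)/64 = Real.exp (-(6 * Real.log 2)) := by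
            rw [Real.exp_neg, mul_comm, Real.exp_mul, Real.exp_log (by norm_num)]
            norm_num
          rw [this, ← Real.exp_nat_mul]; ring_nf
        rw [this, ← hLε]
        apply Real.exp_le_exp.2
        linarith
      have e2 : ((1:ℝ)/64)^k = (1/32)^k * (1/2)^k := by rw [← mul_pow]; norm_num
      have e3 : ((1:ℝ)/2)^k ≤ 1/2 := pow_le_of_le_one (by norm_num) (by norm_num) (by omega)
      have e4 : ((1:ℝ)/32)^k ≤ (3/32)^k := by gcongr; norm_num
      calc ε ≤ (1/32)^k * (1/2)^k := by rw [← e2]; exact e1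
        _ ≤ (3/32)^k * (1/2) := by gcongr
        _ = _ := by ring
    · have h2 := a_le n (k * (√m / 2)) (k * (√m / 2)) (by positivity) le_rfl
      have h1 : √(n * L) ≤ 128 * (k * (√m / 2)) := by
        rw [Real.sqrt_le_left (by positivity)]
        have e : (128 * (k * (√(m:ℝ) / 2)))^2 = 4096 * (k^2 * m) := by
          have : √(m:ℝ)^2 = m := Real.sq_sqrt (by positivity)
          calc _ = 4096 * (k^2 * √(m:ℝ)^2) := by ring
            _ = _ := by rw [this]
        rw [e]
        have hL12 : L ≤ 12 * k := by nlinarith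
        calc (n:ℝ) * L ≤ (2 * (k * m)) * (12 * k) := by gcongr
          _ ≤ _ := by
            have : 0 ≤ (k:ℝ)^2 * m := by positivity
            nlinarith
      have hN := NN_nonneg n (k * (√m / 2))
      calc 1/64 * NN n (k * (√m / 2)) * √(n * L)
          ≤ 1/64 * NN n (k * (√m / 2)) * (128 * (k * (√m / 2))) := by gcongr
        _ = 2 * ((k * (√m / 2)) * NN n (k * (√m / 2))) := by ring
        _ ≤ _ := by linarith
end

section
/- For every n ≥ 1 and every 2 ≤ k ≤ 2^n, there exists a function f : {±1}^n → {0,1} that is the indicator of an intersection of at most k halfspaces and satisfies as(f) ≥ c · sqrt(n · log(k)) for an absolute constant c > 0. -/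
open Real Finset

def wt {n : ℕ} (v : Fin n → Bool) : ℕ := (univ.filter (fun i => v i = true)).card

def xr {n : ℕ} (u x : Fin n → Bool) : Fin n → Bool := fun i => xor (u i) (x i)

lemma card_wt (n s : ℕ) : (univ.filter (fun v : Fin n → Bool => wt v = s)).card = n.choose s := by
  have h := Finset.card_powersetCard s (univ : Finset (Fin n))
  rw [Finset.card_univ, Fintype.card_fin] at h
  rw [← h]
  refine Finset.card_bij' (fun v _ => univ.filter (fun i => v i = true))
    (fun t _ => fun i => decide (i ∈ t)) ?_ ?_ ?_ ?_
  · intro v hv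
    have := (Finset.mem_filter.1 hv).2
    simpa [Finset.mem_powersetCard, wt] using this
  · intro t ht
    refine Finset.mem_filter.2 ⟨Finset.mem_univ _, ?_⟩
    simpa [Finset.mem_powersetCard, wt] using ht
  · intro v hv
    ext i; simp
  · intro t ht
    ext i; simp

lemma telesc (n s b : ℕ) (h : s ≤ b) :
    ∑ i ∈ Finset.Ico s b, (2 * (i : ℝ) - n) * (n.choose i : ℝ)
      = s * (n.choose s : ℝ) - b * (n.choose b : ℝ) := by
  induction b, h using Nat.le_induction with
  | base => simp
  | succ b hb ih =>
    rw [Finset.sum_Ico_succ_top hb, ih]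
    have h1 : ((n.choose (b+1) : ℝ)) * (b + 1) = (n.choose b : ℝ) * (n - b) := by
      rcases le_or_gt b n with h | h
      · have := Nat.choose_succ_right_eq n b
        have h2 : ((n - b : ℕ) : ℝ) = n - b := by push_cast [h]; ring
        rw [← h2]; exact_mod_cast this
      · rw [Nat.choose_eq_zero_of_lt h, Nat.choose_eq_zero_of_lt (by omega)]; simp
    push_cast
    linarith

lemma wt_le {n : ℕ} (v : Fin n → Bool) : wt v ≤ n := by
  unfold wt
  exact (Finset.card_le_univ _).trans (by simp)

lemma card_tail (n s : ℕ) : (univ.filter (fun v : Fin n → Bool => s ≤ wt v)).card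
    = ∑ i ∈ Finset.Ico s (n+1), n.choose i := by
  rw [Finset.card_eq_sum_card_fiberwise (f := wt) (t := Finset.Ico s (n+1))]
  · refine Finset.sum_congr rfl fun i hi => ?_
    rw [← card_wt, Finset.filter_filter]
    congr 1
    ext v
    simp only [Finset.mem_filter, Finset.mem_univ, true_and, Finset.mem_Ico] at *
    omega
  · intro v hv
    have := wt_le v
    simp at hv ⊢
    omega

lemma hazard (n s : ℕ) :
    (2 * (s : ℝ) - n) * ((univ.filter (fun v : Fin n → Bool => s ≤ wt v)).card : ℝ)
      ≤ s * ((univ.filter (fun v : Fin n → Bool => wt v = s)).card : ℝ) := by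
  rw [card_tail, card_wt]
  rcases le_or_gt s (n+1) with h | h
  · have := telesc n s (n+1) h
    rw [Nat.choose_succ_self] at this
    simp only [Nat.cast_zero, mul_zero, sub_zero] at this
    rw [← this, Nat.cast_sum, Finset.mul_sum]
    refine Finset.sum_le_sum fun i hi => ?_
    have : (s : ℝ) ≤ i := by exact_mod_cast (Finset.mem_Ico.1 hi).1
    gcongr
  · rw [Finset.Ico_eq_empty (by omega)]
    simp
    positivity

lemma sgn_sum {n : ℕ} (v : Fin n → Bool) : ∑ i, sgn (v i) = 2 * (wt v : ℝ) - n := by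
  have : ∀ i, sgn (v i) = 2 * (if v i = true then (1:ℝ) else 0) - 1 := by
    intro i; unfold sgn; split_ifs <;> norm_num
  simp only [this, Finset.sum_sub_distrib, ← Finset.mul_sum, wt]
  simp

lemma sgn_xr {n : ℕ} (u x : Fin n → Bool) :
    ∑ i, sgn (u i) * sgn (x i) = n - 2 * (wt (xr u x) : ℝ) := by
  have : ∀ i, sgn (u i) * sgn (x i) = - sgn (xr u x i) := by
    intro i; unfold sgn xr; cases u i <;> cases x i <;> simp
  simp only [this, Finset.sum_neg_distrib, sgn_sum]
  ring

lemma half_iff {n : ℕ} (s : ℕ) (u x : Fin n → Bool) :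
    ((n : ℝ) - 2 * s + 1 ≤ ∑ i, sgn (u i) * sgn (x i)) ↔ wt (xr u x) < s := by
  rw [sgn_xr]
  constructor
  · intro h
    by_contra! h'
    have : (s : ℝ) ≤ wt (xr u x) := by exact_mod_cast h'
    linarith
  · intro h
    have : (wt (xr u x) : ℝ) + 1 ≤ s := by exact_mod_cast h
    linarith

/-- flipping lemma -/
lemma wt_flip_dec {n : ℕ} (u x : Fin n → Bool) (i : Fin n) (h : xr u x i = true) :
    wt (xr u (flip' x i)) + 1 = wt (xr u x) := by
  unfold wt
  have : (univ.filter (fun j => xr u (flip' x i) j = true))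
      = (univ.filter (fun j => xr u x j = true)).erase i := by
    ext j
    by_cases hj : j = i
    · subst hj
      simp [xr, flip'] at *
      simp [h]
    · simp [xr, flip', Function.update_of_ne hj, hj]
  rw [this, Finset.card_erase_add_one (by simpa using h)]

lemma xr_invol {n : ℕ} (u x : Fin n → Bool) : xr (xr u x) x = u := by
  funext i; simp [xr]

lemma card_xr {n : ℕ} (x : Fin n → Bool) (p : (Fin n → Bool) → Prop) [DecidablePred p] :
    (univ.filter (fun u => p (xr u x))).card = (univ.filter p).card := by
  refine Finset.card_bij' (fun u _ => xr u x) (fun u _ => xr u x) ?_ ?_ ?_ ?_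
  · intro u hu
    exact Finset.mem_filter.2 ⟨Finset.mem_univ _, (Finset.mem_filter.1 hu).2⟩
  · intro u hu
    refine Finset.mem_filter.2 ⟨Finset.mem_univ _, ?_⟩
    rw [xr_invol]; exact (Finset.mem_filter.1 hu).2
  · intro u hu; exact xr_invol u x
  · intro u hu; exact xr_invol u x

lemma sum_a (n s : ℕ) :
    ∑ i : Fin n, (univ.filter (fun v : Fin n → Bool => wt v = s ∧ v i = true)).card
      = s * (univ.filter (fun v : Fin n → Bool => wt v = s)).card := by
  simp only [Finset.card_filter, ite_and]
  rw [Finset.sum_comm, Finset.mul_sum]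
  refine Finset.sum_congr rfl fun v _ => ?_
  split_ifs with h
  · rw [← Finset.card_filter, mul_one]; exact h
  · simp

def setA {n : ℕ} (s : ℕ) (x : Fin n → Bool) (i : Fin n) : Finset (Fin n → Bool) :=
  univ.filter (fun u => wt (xr u x) = s ∧ xr u x i = true)

def setB {n : ℕ} (s : ℕ) (x : Fin n → Bool) (i : Fin n) : Finset (Fin n → Bool) :=
  univ.filter (fun u => wt (xr u x) < s ∧ wt (xr u (flip' x i)) < s)

lemma card_A {n : ℕ} (s : ℕ) (x : Fin n → Bool) (i : Fin n) :
    (setA s x i).card = (univ.filter (fun v : Fin n → Bool => wt v = s ∧ v i = true)).card :=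
  card_xr x (fun v => wt v = s ∧ v i = true)

lemma card_B {n : ℕ} (s : ℕ) (x : Fin n → Bool) (i : Fin n) :
    2 ^ n ≤ (setB s x i).card + 2 * (univ.filter (fun v : Fin n → Bool => s ≤ wt v)).card := by
  have h1 := card_xr x (fun v => s ≤ wt v)
  have h2 := card_xr (flip' x i) (fun v => s ≤ wt v)
  have h3 : (univ : Finset (Fin n → Bool)) ⊆ setB s x i ∪
      (univ.filter (fun u => s ≤ wt (xr u x)) ∪
        univ.filter (fun u => s ≤ wt (xr u (flip' x i)))) := by
    intro u _
    simp only [setB, Finset.mem_union, Finset.mem_filter, Finset.mem_univ, true_and]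
    omega
  have h4 := (Finset.card_le_card h3).trans (Finset.card_union_le _ _)
  have h5 := Finset.card_union_le (univ.filter (fun u => s ≤ wt (xr u x)))
        (univ.filter (fun u => s ≤ wt (xr u (flip' x i))))
  have h6 : (univ : Finset (Fin n → Bool)).card = 2 ^ n := by simp
  omega

/-- the event that `j` is the unique pivot at the edge `(x, i)` -/
def ev {n m : ℕ} (s : ℕ) (x : Fin n → Bool) (i : Fin n) (j : Fin m) :
    Finset (Fin m → Fin n → Bool) :=
  Fintype.piFinset (fun j' => if j' = j then setA s x i else setB s x i)

lemma card_ev {n m : ℕ} (s : ℕ) (x : Fin n → Bool) (i : Fin n) (j : Fin m) :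
    (ev s x i j).card = (setA s x i).card * (setB s x i).card ^ (m - 1) := by
  unfold ev
  rw [Fintype.card_piFinset, ← Finset.mul_prod_erase univ _ (Finset.mem_univ j)]
  congr 1
  · simp
  · rw [Finset.prod_congr rfl (g := fun _ => (setB s x i).card)]
    · rw [Finset.prod_const, Finset.card_erase_of_mem (Finset.mem_univ j)]; simp
    · intro j' hj
      rw [if_neg (Finset.ne_of_mem_erase hj)]

lemma ev_A {n m : ℕ} {s : ℕ} {x : Fin n → Bool} {i : Fin n} {j : Fin m}
    {U : Fin m → Fin n → Bool} (h : U ∈ ev s x i j) :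
    wt (xr (U j) x) = s ∧ xr (U j) x i = true := by
  have := Fintype.mem_piFinset.1 h j
  rw [if_pos rfl] at this
  exact (Finset.mem_filter.1 this).2

lemma ev_B {n m : ℕ} {s : ℕ} {x : Fin n → Bool} {i : Fin n} {j j' : Fin m} (hj : j' ≠ j)
    {U : Fin m → Fin n → Bool} (h : U ∈ ev s x i j) :
    wt (xr (U j') x) < s ∧ wt (xr (U j') (flip' x i)) < s := by
  have := Fintype.mem_piFinset.1 h j'
  rw [if_neg hj] at this
  exact (Finset.mem_filter.1 this).2

noncomputable def fU {n m : ℕ} (s : ℕ) (U : Fin m → Fin n → Bool) (x : Fin n → Bool) : ℝ :=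
  if ∀ j, wt (xr (U j) x) < s then 1 else 0

lemma ev_sens {n m : ℕ} (s : ℕ) (x : Fin n → Bool) (i : Fin n)
    (U : Fin m → Fin n → Bool) :
    ∑ j, (if U ∈ ev s x i j then (1:ℝ) else 0)
      ≤ if fU s U x ≠ fU s U (flip' x i) then 1 else 0 := by
  by_cases h : ∃ j, U ∈ ev s x i j
  · obtain ⟨j, hj⟩ := h
    have h1 : ∑ j, (if U ∈ ev s x i j then (1:ℝ) else 0) = 1 := by
      rw [Finset.sum_eq_single j]
      · simp [hj]
      · intro j' _ hne
        rw [if_neg]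
        intro h'
        have a := (ev_A h').1
        have b := (ev_B hne hj).1
        omega
      · simp
    have h2 : fU s U x = 0 := by
      unfold fU
      rw [if_neg]
      intro h
      have := h j
      have := (ev_A hj).1
      omega
    have h3 : fU s U (flip' x i) = 1 := by
      unfold fU
      rw [if_pos]
      intro j'
      by_cases hne : j' = j
      · subst hne
        have := wt_flip_dec (U j') x i (ev_A hj).2
        have := (ev_A hj).1
        omega
      · exact (ev_B hne hj).2
    rw [h1, h2, h3]; simp
  · push Not at h
    simp only [h, if_false, Finset.sum_const_zero]
    split_ifs <;> norm_num

lemma exists_U (n m s : ℕ) (hm : 1 ≤ m)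
    (hT : ((m:ℝ) - 1) * ((univ.filter (fun v : Fin n → Bool => s ≤ wt v)).card / 2 ^ n) ≤ 1 / 4) :
    ∃ U : Fin m → Fin n → Bool,
      (m : ℝ) * (s * ((univ.filter (fun v : Fin n → Bool => wt v = s)).card : ℝ)) / 2 / 2 ^ n
        ≤ avgSens (fU s U) := by
  set t : ℝ := ((univ.filter (fun v : Fin n → Bool => s ≤ wt v)).card : ℝ) with ht
  set N : ℝ := ((univ.filter (fun v : Fin n → Bool => wt v = s)).card : ℝ) with hN
  have hm1 : (1:ℝ) ≤ m := by exact_mod_cast hm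
  have hB : ∀ (x : Fin n → Bool) (i : Fin n),
      (1/2 : ℝ) * (2 ^ n) ^ (m - 1) ≤ ((setB s x i).card : ℝ) ^ (m - 1) := by
    intro x i
    have h1 : (2:ℝ) ^ n ≤ (setB s x i).card + 2 * t := by
      rw [ht]; exact_mod_cast card_B s x i
    have hp : (0:ℝ) < 2 ^ n := by positivity
    set q : ℝ := (setB s x i).card / 2 ^ n with hq
    have hq0 : 0 ≤ q := by positivity
    have h2 : 1 - q ≤ 2 * (t / 2 ^ n) := by
      rw [hq, ← mul_div_assoc, le_div_iff₀ hp, sub_mul, div_mul_cancel₀ _ hp.ne']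
      linarith
    have h3 := one_add_mul_le_pow (a := q - 1) (by linarith) (m - 1)
    have h4 : ((m - 1 : ℕ) : ℝ) = m - 1 := by push_cast [hm]; ring
    rw [h4] at h3
    have h5 : 1 / 2 ≤ q ^ (m - 1) := by
      have : ((m:ℝ) - 1) * (1 - q) ≤ (m - 1) * (2 * (t / 2 ^ n)) := by
        apply mul_le_mul_of_nonneg_left h2; linarith
      have e : 1 + (q - 1) = q := by ring
      rw [e] at h3
      nlinarith
    rw [hq, div_pow, le_div_iff₀ (by positivity)] at h5
    exact h5
  have key : ∑ U : Fin m → Fin n → Bool, (m : ℝ) * (s * N) / 2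
      ≤ ∑ U : Fin m → Fin n → Bool, ∑ x : Fin n → Bool, ∑ i : Fin n,
        (if fU s U x ≠ fU s U (flip' x i) then (1:ℝ) else 0) := by
    have e1 : ∑ U : Fin m → Fin n → Bool, ∑ x : Fin n → Bool, ∑ i : Fin n,
        ∑ j, (if U ∈ ev s x i j then (1:ℝ) else 0)
        ≤ ∑ U : Fin m → Fin n → Bool, ∑ x : Fin n → Bool, ∑ i : Fin n,
        (if fU s U x ≠ fU s U (flip' x i) then (1:ℝ) else 0) := by
      gcongr
      exact ev_sens _ _ _ _
    refine le_trans ?_ e1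
    rw [Finset.sum_comm]
    have e2 : ∀ x : Fin n → Bool, (2 ^ n) ^ (m - 1) * ((m : ℝ) * (s * N) / 2) ≤
        ∑ U : Fin m → Fin n → Bool, ∑ i : Fin n,
        ∑ j, (if U ∈ ev s x i j then (1:ℝ) else 0) := by
      intro x
      rw [Finset.sum_comm]
      have e3 : ∀ i : Fin n,
          (m : ℝ) * (((univ.filter (fun v : Fin n → Bool => wt v = s ∧ v i = true)).card : ℝ)
            * ((1/2 : ℝ) * (2 ^ n) ^ (m - 1))) ≤
          ∑ U : Fin m → Fin n → Bool, ∑ j, (if U ∈ ev s x i j then (1:ℝ) else 0) := by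
        intro i
        rw [Finset.sum_comm]
        have e4 : ∀ j : Fin m, ∑ U : Fin m → Fin n → Bool, (if U ∈ ev s x i j then (1:ℝ) else 0)
            = ((setA s x i).card : ℝ) * ((setB s x i).card : ℝ) ^ (m - 1) := by
          intro j
          have := card_ev s x i j
          rw [Finset.sum_ite_mem]
          simp only [Finset.univ_inter, Finset.sum_const, nsmul_eq_mul, mul_one]
          exact_mod_cast this
        simp only [e4, Finset.sum_const, nsmul_eq_mul, Finset.card_univ, Fintype.card_fin]
        rw [card_A]
        gcongr
        exact hB x i
      refine le_trans (le_of_eq ?_) (Finset.sum_le_sum fun i _ => e3 i)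
      rw [← Finset.mul_sum, ← Finset.sum_mul]
      have := sum_a n s
      have h' : ∑ i : Fin n, ((univ.filter (fun v : Fin n → Bool => wt v = s ∧ v i = true)).card : ℝ)
        = s * N := by rw [hN]; exact_mod_cast this
      rw [h']; ring
    refine le_trans (le_of_eq ?_) (Finset.sum_le_sum fun x _ => e2 x)
    simp only [Finset.sum_const, nsmul_eq_mul, Finset.card_univ, Fintype.card_fun,
      Fintype.card_fin, Fintype.card_bool]
    push_cast
    obtain ⟨m', rfl⟩ : ∃ m', m = m' + 1 := ⟨m - 1, by omega⟩
    rw [pow_succ]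
    simp only [Nat.add_sub_cancel]
    ring
  obtain ⟨U, _, hU⟩ := Finset.exists_le_of_sum_le Finset.univ_nonempty key
  refine ⟨U, ?_⟩
  unfold avgSens
  gcongr

lemma mgf_s10 (n : ℕ) (l : ℝ) :
    ∑ v : Fin n → Bool, Real.exp (l * (2 * (wt v : ℝ) - n)) = (2 * Real.cosh l) ^ n := by
  have h : ∀ v : Fin n → Bool, Real.exp (l * (2 * (wt v : ℝ) - n))
      = ∏ i, Real.exp (l * sgn (v i)) := by
    intro v; rw [← sgn_sum, Finset.mul_sum, Real.exp_sum]
  simp only [h]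
  have := Finset.prod_univ_sum (fun _ : Fin n => (univ : Finset Bool))
    (fun _ b => Real.exp (l * sgn b))
  rw [Fintype.piFinset_univ] at this
  rw [← this]
  simp [sgn, Real.cosh_eq]
  congr 1; ring

/-- Paley-Zygmund for finite sums -/
lemma pz {ι : Type*} [Fintype ι] (Z : ι → ℝ) (a : ℝ) (ha : 0 ≤ a)
    (h : ∑ v, Z v = 2 * (Fintype.card ι * a)) :
    (Fintype.card ι * a) ^ 2 ≤ ((univ.filter (fun v => a ≤ Z v)).card : ℝ) * ∑ v, Z v ^ 2 := by
  have h1 := Finset.sum_filter_add_sum_filter_not univ (fun v => a ≤ Z v) Z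
  have h2 : ∑ v ∈ univ.filter (fun v => ¬ a ≤ Z v), Z v ≤ Fintype.card ι * a := by
    calc _ ≤ ∑ v ∈ univ.filter (fun v => ¬ a ≤ Z v), a :=
          Finset.sum_le_sum fun v hv => by
            have := (Finset.mem_filter.1 hv).2; linarith
      _ ≤ ∑ v : ι, a := Finset.sum_le_sum_of_subset_of_nonneg (Finset.filter_subset _ _)
          (fun _ _ _ => ha)
      _ = _ := by simp
  have h3 : (Fintype.card ι * a) ≤ ∑ v ∈ univ.filter (fun v => a ≤ Z v), Z v := by linarith
  have h4 : (∑ v ∈ univ.filter (fun v => a ≤ Z v), Z v) ^ 2 ≤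
      ((univ.filter (fun v => a ≤ Z v)).card : ℝ) * ∑ v ∈ univ.filter (fun v => a ≤ Z v), Z v ^ 2 :=
    sq_sum_le_card_mul_sum_sq
  have h5 : ∑ v ∈ univ.filter (fun v => a ≤ Z v), Z v ^ 2 ≤ ∑ v, Z v ^ 2 :=
    Finset.sum_le_sum_of_subset_of_nonneg (Finset.filter_subset _ _)
          (fun _ _ _ => sq_nonneg _)
  calc _ ≤ (∑ v ∈ univ.filter (fun v => a ≤ Z v), Z v) ^ 2 := by gcongr
    _ ≤ _ := h4
    _ ≤ _ := by gcongr

lemma exp_le_cosh (l : ℝ) (hl : 0 ≤ l) (h : l ^ 2 ≤ 1) : Real.exp (l ^ 2 / 4) ≤ Real.cosh l := by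
  have h1 : 1 + l ^ 2 / 2 ≤ Real.cosh l := by
    have a1 : l / 2 ≤ Real.sinh (l / 2) := Real.self_le_sinh_iff.2 (by linarith)
    have a2 := Real.cosh_two_mul (l / 2)
    have a3 := Real.cosh_sq (l / 2)
    rw [show 2 * (l / 2) = l by ring] at a2
    nlinarith
  have h2 : 1 - l ^ 2 / 4 ≤ Real.exp (-(l ^ 2 / 4)) := by
    have := Real.add_one_le_exp (-(l ^ 2 / 4)); linarith
  have h3 : Real.exp (l^2/4) * Real.exp (-(l ^ 2 / 4)) = 1 := by
    rw [← Real.exp_add]; simp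
  have h4 := Real.exp_pos (l^2/4)
  have h6 : Real.exp (l^2/4) * (1 - l^2/4) ≤ 1 := by nlinarith
  have h7 : 1 ≤ (1 + l^2/2) * (1 - l^2/4) := by nlinarith [sq_nonneg l]
  have h8 : Real.exp (l^2/4) ≤ 1 + l^2/2 := by
    have : 0 < 1 - l^2/4 := by linarith
    exact le_of_mul_le_mul_right (h6.trans h7) this
  linarith

lemma tail_pz (n : ℕ) (hn : 1 ≤ n) (L : ℝ) (hL : 8 ≤ L) (hLn : L ≤ n) :
    Real.exp (-(2 * L)) / 4 ≤
      ((univ.filter (fun v : Fin n → Bool => Real.sqrt (n * L) / 8 ≤ 2 * (wt v : ℝ) - n)).card : ℝ)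
        / 2 ^ n := by
  have hn0 : (0:ℝ) < n := by exact_mod_cast hn
  have hL0 : 0 < L := by linarith
  set l := Real.sqrt (L / n) with hl
  have hl2 : l ^ 2 = L / n := Real.sq_sqrt (by positivity)
  have hl0 : 0 < l := Real.sqrt_pos.2 (by positivity)
  have hl1 : l ^ 2 ≤ 1 := by rw [hl2, div_le_one hn0]; exact hLn
  have hnl : n * l ^ 2 = L := by rw [hl2]; field_simp
  have hsq : Real.sqrt (n * L) = n * l := by
    rw [← hnl, show (n:ℝ) * (n * l^2) = (n * l)^2 by ring, Real.sqrt_sq (by positivity)]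
  have P := pz (fun v : Fin n → Bool => Real.exp (l * (2 * (wt v : ℝ) - n)))
    (Real.cosh l ^ n / 2) (by have := Real.cosh_pos l; positivity)
    (by rw [mgf_s10, mul_pow]; simp; ring)
  have e : ∀ v : Fin n → Bool, Real.exp (l * (2 * (wt v : ℝ) - n)) ^ 2
      = Real.exp ((2 * l) * (2 * (wt v : ℝ) - n)) := by
    intro v; rw [← Real.exp_nat_mul]; congr 1; push_cast; ring
  simp only [e, mgf_s10] at P
  have hcard : ((Fintype.card (Fin n → Bool) : ℕ) : ℝ) = 2 ^ n := by simp
  rw [hcard] at P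
  have hsub : univ.filter (fun v : Fin n → Bool =>
        Real.cosh l ^ n / 2 ≤ Real.exp (l * (2 * (wt v : ℝ) - n))) ⊆
      univ.filter (fun v : Fin n → Bool => Real.sqrt (n * L) / 8 ≤ 2 * (wt v : ℝ) - n) := by
    intro v hv
    have hv := (Finset.mem_filter.1 hv).2
    refine Finset.mem_filter.2 ⟨Finset.mem_univ _, ?_⟩
    have h1 : Real.exp (L / 4) ≤ Real.cosh l ^ n := by
      calc Real.exp (L / 4) = Real.exp (l ^ 2 / 4) ^ n := by
            rw [← Real.exp_nat_mul]; congr 1; rw [← hnl]; ring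
        _ ≤ _ := by gcongr; exact exp_le_cosh l hl0.le hl1
    have h2 : (2:ℝ) ≤ Real.exp 1 := by have := Real.add_one_le_exp (1:ℝ); linarith
    have h3 : Real.exp (L / 8) ≤ Real.exp (l * (2 * (wt v : ℝ) - n)) := by
      have h4 : Real.exp (L/4) = Real.exp (L/8) * Real.exp (L/8) := by
        rw [← Real.exp_add]; congr 1; ring
      have h5 : Real.exp 1 ≤ Real.exp (L/8) := Real.exp_le_exp.2 (by linarith)
      have h6 := Real.exp_pos (L/8)
      nlinarith
    have h4 := Real.exp_le_exp.1 h3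
    rw [hsq]
    rw [← hnl] at h4
    have : l * (n * l / 8) ≤ l * (2 * (wt v : ℝ) - n) := by linarith
    exact le_of_mul_le_mul_left this hl0
  have hc := Finset.card_le_card hsub
  have hc' : ((univ.filter (fun v : Fin n → Bool =>
        Real.cosh l ^ n / 2 ≤ Real.exp (l * (2 * (wt v : ℝ) - n)))).card : ℝ) ≤
      ((univ.filter (fun v : Fin n → Bool =>
        Real.sqrt (n * L) / 8 ≤ 2 * (wt v : ℝ) - n)).card : ℝ) := by exact_mod_cast hc
  set X := ((univ.filter (fun v : Fin n → Bool =>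
        Real.sqrt (n * L) / 8 ≤ 2 * (wt v : ℝ) - n)).card : ℝ) with hX
  have c1 : Real.cosh (2 * l) ^ n ≤ Real.exp (2 * L) := by
    calc Real.cosh (2 * l) ^ n ≤ Real.exp ((2 * l) ^ 2 / 2) ^ n := by
          have := Real.cosh_pos (2 * l)
          gcongr; exact Real.cosh_le_exp_half_sq _
      _ = _ := by rw [← Real.exp_nat_mul]; congr 1; rw [← hnl]; ring
  have c2 : 1 ≤ Real.cosh l ^ n := one_le_pow₀ (Real.one_le_cosh l)
  have hp : (0:ℝ) < 2 ^ n := by positivity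
  have c3 : (2 ^ n * (1 / 2)) ^ 2 ≤ X * (2 ^ n * Real.exp (2 * L)) := by
    calc ((2:ℝ) ^ n * (1 / 2)) ^ 2 ≤ (2 ^ n * (Real.cosh l ^ n / 2)) ^ 2 := by gcongr
      _ ≤ _ := P
      _ ≤ X * (2 ^ n * Real.exp (2 * L)) := by
        rw [mul_pow]
        have := Real.cosh_pos (2 * l)
        gcongr
  rw [le_div_iff₀ hp, Real.exp_neg]
  have hE := Real.exp_pos (2 * L)
  have c4 : 2 ^ n / 4 ≤ X * Real.exp (2 * L) := by
    have : (2:ℝ) ^ n * (2 ^ n / 4) ≤ 2 ^ n * (X * Real.exp (2 * L)) := by nlinarith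
    exact le_of_mul_le_mul_left this hp
  rw [← div_le_iff₀ hE] at c4
  calc _ = 2 ^ n / 4 / Real.exp (2 * L) := by field_simp
    _ ≤ X := c4

lemma tail_lower : ∃ α c : ℝ, 0 < α ∧ α ≤ 1 / 4 ∧ 0 < c ∧
    ∀ n k : ℕ, 1 ≤ n → 2 ≤ k → k ≤ 2 ^ n → ∃ s : ℕ,
      c * Real.sqrt (n * Real.log k) ≤ 2 * (s : ℝ) - n ∧
      α / k ≤ ((univ.filter (fun v : Fin n → Bool => s ≤ wt v)).card : ℝ) / 2 ^ n := by
  refine ⟨Real.exp (-16) / 4, 1 / 16, by positivity, ?_, by norm_num, ?_⟩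
  · have : Real.exp (-16) ≤ 1 := Real.exp_le_one_iff.2 (by norm_num)
    linarith
  intro n k hn hk hkn
  have hn0 : (0:ℝ) < n := by exact_mod_cast hn
  have hk1 : (1:ℝ) ≤ k := by exact_mod_cast (by omega : 1 ≤ k)
  have hlog0 : 0 ≤ Real.log k := Real.log_nonneg hk1
  have hlog : Real.log k ≤ n := by
    have h1 : Real.log k ≤ Real.log (2 ^ n) := Real.log_le_log (by linarith) (by exact_mod_cast hkn)
    rw [Real.log_pow] at h1
    have h2 : Real.log 2 ≤ 1 := by have := Real.log_two_lt_d9; linarith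
    nlinarith
  rcases lt_or_ge n 16 with h | h
  · refine ⟨n, ?_, ?_⟩
    · have : Real.sqrt (n * Real.log k) ≤ n := by
        rw [Real.sqrt_le_left hn0.le]; nlinarith
      linarith
    · have h1 : (1:ℝ) ≤ ((univ.filter (fun v : Fin n → Bool => n ≤ wt v)).card : ℝ) := by
        have : 0 < (univ.filter (fun v : Fin n → Bool => n ≤ wt v)).card :=
          Finset.card_pos.2 ⟨fun _ => true, Finset.mem_filter.2 ⟨Finset.mem_univ _, by simp [wt]⟩⟩
        exact_mod_cast this
      have h2 : (2:ℝ) ^ n ≤ Real.exp 16 := by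
        have h2 : (2:ℝ) ≤ Real.exp 1 := by have := Real.add_one_le_exp (1:ℝ); linarith
        calc (2:ℝ) ^ n ≤ 2 ^ 16 := pow_le_pow_right₀ (by norm_num) h.le
          _ ≤ Real.exp 1 ^ 16 := by gcongr
          _ = _ := by rw [← Real.exp_nat_mul]; norm_num
      have hE := Real.exp_pos (-16)
      calc Real.exp (-16) / 4 / k ≤ Real.exp (-16) / 4 := div_le_self (by positivity) hk1
        _ ≤ Real.exp (-16) := by linarith
        _ = 1 / Real.exp 16 := by rw [Real.exp_neg]; simp
        _ ≤ _ := by gcongr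
  · have h16 : (16:ℝ) ≤ n := by exact_mod_cast h
    have T := tail_pz n hn (8 + Real.log k / 2) (by linarith) (by linarith)
    set L := 8 + Real.log k / 2 with hL
    refine ⟨⌈(n + Real.sqrt (n * L) / 8) / 2⌉₊, ?_, ?_⟩
    · have h1 := Nat.le_ceil (((n:ℝ) + Real.sqrt (n * L) / 8) / 2)
      have h2 : Real.sqrt (n * Real.log k) ≤ 2 * Real.sqrt (n * L) := by
        rw [show (2:ℝ) = Real.sqrt (2^2) by rw [Real.sqrt_sq]; norm_num,
          ← Real.sqrt_mul (by norm_num)]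
        apply Real.sqrt_le_sqrt
        nlinarith
      linarith
    · have e : Real.exp (-16) / 4 / k = Real.exp (-(2 * L)) / 4 := by
        rw [hL, show -(2 * (8 + Real.log k / 2)) = -16 + -Real.log k by ring, Real.exp_add,
          Real.exp_neg (Real.log k), Real.exp_log (by linarith)]
        ring
      rw [e]
      refine T.trans (le_of_eq ?_)
      congr 3
      ext v
      simp only [Finset.mem_filter, Finset.mem_univ, true_and, Nat.ceil_le]
      constructor <;> intro h <;> linarith

theorem stmt_10 :
    ∃ c : ℝ, 0 < c ∧ ∀ (n k : ℕ), 1 ≤ n → 2 ≤ k → k ≤ 2 ^ n →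
      ∃ (w : Fin k → Fin n → ℝ) (θ : Fin k → ℝ),
        c * Real.sqrt (n * Real.log k) ≤
          avgSens (fun x => if ∀ j, θ j ≤ ∑ i : Fin n, w j i * sgn (x i)
            then (1 : ℝ) else 0) := by
  obtain ⟨α, c, hα, hα4, hc, H⟩ := tail_lower
  refine ⟨α * c / 2, by positivity, ?_⟩
  intro n k hn hk hkn
  obtain ⟨s, hs, hT⟩ := H n k hn hk hkn
  set T : ℝ := ((univ.filter (fun v : Fin n → Bool => s ≤ wt v)).card : ℝ) / 2 ^ n with hTd
  have hk0 : (0:ℝ) < k := by exact_mod_cast (by omega : 0 < k)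
  have hT0 : 0 < T := lt_of_lt_of_le (by positivity) hT
  set m := ⌈α / T⌉₊ with hm
  have hm1 : 1 ≤ m := Nat.ceil_pos.2 (by positivity)
  have hmk : m ≤ k := by
    rw [hm, Nat.ceil_le, div_le_iff₀ hT0]
    rw [div_le_iff₀ hk0] at hT
    linarith
  have hmT : α ≤ m * T := by
    rw [← div_le_iff₀ hT0]; exact Nat.le_ceil _
  have hmT' : ((m:ℝ) - 1) * T ≤ 1 / 4 := by
    have : (m:ℝ) < α / T + 1 := Nat.ceil_lt_add_one (by positivity)
    have : ((m:ℝ) - 1) * T ≤ α / T * T := by gcongr; linarith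
    rw [div_mul_cancel₀ _ hT0.ne'] at this
    linarith
  obtain ⟨U, hU⟩ := exists_U n m s hm1 hmT'
  have : Nonempty (Fin m) := ⟨⟨0, hm1⟩⟩
  set g : Fin k → Fin m := Function.invFun (Fin.castLE hmk) with hg
  have hgs : Function.Surjective g := Function.invFun_surjective (Fin.castLE_injective hmk)
  refine ⟨fun j i => sgn (U (g j) i), fun _ => (n:ℝ) - 2 * s + 1, ?_⟩
  have hf : (fun x => if ∀ j : Fin k, (n:ℝ) - 2 * s + 1 ≤ ∑ i : Fin n, sgn (U (g j) i) * sgn (x i)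
            then (1 : ℝ) else 0) = fU s U := by
    funext x
    unfold fU
    simp only [half_iff]
    have := hgs.forall (p := fun j => wt (xr (U j) x) < s)
    simp only [this]
  beta_reduce
  rw [hf]
  refine le_trans ?_ hU
  have hz := hazard n s
  have hz' : (2 * (s:ℝ) - n) * T ≤
      s * ((univ.filter (fun v : Fin n → Bool => wt v = s)).card : ℝ) / 2 ^ n := by
    rw [hTd, ← mul_div_assoc]; gcongr
  have h0 : 0 ≤ 2 * (s:ℝ) - n := le_trans (by positivity) hs
  calc α * c / 2 * Real.sqrt (n * Real.log k) = α * (c * Real.sqrt (n * Real.log k)) / 2 := by ring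
    _ ≤ (m * T) * (2 * (s:ℝ) - n) / 2 := by gcongr
    _ = m * ((2 * (s:ℝ) - n) * T) / 2 := by ring
    _ ≤ m * (s * ((univ.filter (fun v : Fin n → Bool => wt v = s)).card : ℝ) / 2 ^ n) / 2 := by
      gcongr
    _ = _ := by ring
end
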